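/- Decomposition of the jump relations: the Rankine–Hugoniot relation holds if and only if the following three relations hold simultaneously: (i) π_II sinh²(W_II − Z) = π_I sinh²(W_I − Z) + p_I − p_II; (ii) π_II sinh(2(W_II − Z)) = π_I sinh(2(W_I − Z)); (iii) π_II sinh(W_II − Z)(1+|u∥_II|²)^{−1/2} u∥_II = π_I sinh(W_I − Z)(1+|u∥_I|²)^{−1/2} u∥_I in ℝ^{d−1}. -/

import Mathlib

open Real

/-- Squared Euclidean norm of a vector. -/
noncomputable def nsq {n : ℕ} (w : Fin n → ℝ) : ℝ := ∑ j, (w j) ^ 2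

/-- Minkowski bilinear form on `ℝ^{d+1}`: `η(x,y) = -x₀y₀ + ∑_{j=1}^d xⱼyⱼ`. -/
noncomputable def eta {d : ℕ} (x y : Fin (d + 1) → ℝ) : ℝ :=
  -(x 0 * y 0) + ∑ j : Fin d, x j.succ * y j.succ

/-- Unit spacelike normal `V = (sinh Z, cosh Z, 0, …, 0)` to the interface. -/
noncomputable def normalV (d : ℕ) (Z : ℝ) : Fin (d + 1) → ℝ := fun i =>
  if i.val = 0 then Real.sinh Z else if i.val = 1 then Real.cosh Z else 0

/-- Unit timelike fluid velocity determined by the perpendicular rapidity `W` and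
the parallel velocity `w ∈ ℝ^{d-1}`. -/
noncomputable def vel (d : ℕ) (W : ℝ) (w : Fin (d - 1) → ℝ) : Fin (d + 1) → ℝ := fun i =>
  if i.val = 0 then Real.sqrt (1 + nsq w) * Real.cosh W
  else if i.val = 1 then Real.sqrt (1 + nsq w) * Real.sinh W
  else if h : i.val - 2 < d - 1 then w ⟨i.val - 2, h⟩ else 0

/-- The Rankine–Hugoniot relation
`(μ_II + p_II) η(u_II,V) u_II − (μ_I + p_I) η(u_I,V) u_I + (p_II − p_I) V = 0`. -/
def RH (d : ℕ) (μI pI μII pII : ℝ) (uI uII V : Fin (d + 1) → ℝ) : Prop :=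
  ∀ i, (μII + pII) * eta uII V * uII i - (μI + pI) * eta uI V * uI i + (pII - pI) * V i = 0

lemma nsq_nonneg {n : ℕ} (w : Fin n → ℝ) : 0 ≤ nsq w :=
  Finset.sum_nonneg fun _ _ => sq_nonneg _

section Components

variable (n : ℕ) (W Z : ℝ) (w : Fin n → ℝ)

lemma vel_zero : vel (n + 1) W w 0 = √(1 + nsq w) * cosh W := by
  simp [vel]

lemma vel_one : vel (n + 1) W w (Fin.succ 0) = √(1 + nsq w) * sinh W := by
  simp [vel]

lemma vel_succ_succ (j : Fin n) : vel (n + 1) W w j.succ.succ = w j := by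
  simp [vel]

lemma normalV_zero : normalV (n + 1) Z 0 = sinh Z := by
  simp [normalV]

lemma normalV_one : normalV (n + 1) Z (Fin.succ 0) = cosh Z := by
  simp [normalV]

lemma normalV_succ_succ (j : Fin n) : normalV (n + 1) Z j.succ.succ = 0 := by
  simp [normalV]

lemma eta_vel_normalV :
    eta (vel (n + 1) W w) (normalV (n + 1) Z) = √(1 + nsq w) * sinh (W - Z) := by
  rw [eta, Fin.sum_univ_succ]
  simp only [vel_zero, vel_one, normalV_zero, normalV_one, normalV_succ_succ, mul_zero,
    Finset.sum_const_zero, sinh_sub]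
  ring

end Components

/-- A Lorentz boost of a vector of the plane vanishes exactly when the vector does. -/
lemma boost_eq_zero_iff (P Q Z : ℝ) :
    (P * cosh Z + Q * sinh Z = 0 ∧ Q * cosh Z + P * sinh Z = 0) ↔ Q = 0 ∧ P = 0 := by
  have hZ := cosh_sq_sub_sinh_sq Z
  constructor
  · rintro ⟨h0, h1⟩
    constructor
    · linear_combination cosh Z * h1 - sinh Z * h0 - Q * hZ
    · linear_combination cosh Z * h0 - sinh Z * h1 - P * hZ
  · rintro ⟨rfl, rfl⟩
    simp

/-- Decomposition of the jump relations: the Rankine–Hugoniot relation holds iff the three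
relations (1), (2), (3) hold simultaneously. -/
theorem rankine_hugoniot_decomposition (d : ℕ) (hd : 2 ≤ d) (Z μI μII pI pII WI WII : ℝ)
    (wI wII : Fin (d - 1) → ℝ) (hμI : 0 ≤ μI) (hμII : 0 ≤ μII) :
    RH d μI pI μII pII (vel d WI wI) (vel d WII wII) (normalV d Z) ↔
      (((μII + pII) * (1 + nsq wII)) * Real.sinh (WII - Z) ^ 2
          = ((μI + pI) * (1 + nsq wI)) * Real.sinh (WI - Z) ^ 2 + (pI - pII)
        ∧ ((μII + pII) * (1 + nsq wII)) * Real.sinh (2 * (WII - Z))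
          = ((μI + pI) * (1 + nsq wI)) * Real.sinh (2 * (WI - Z))
        ∧ ∀ j : Fin (d - 1),
            ((μII + pII) * (1 + nsq wII)) * Real.sinh (WII - Z) * (Real.sqrt (1 + nsq wII))⁻¹ * wII j
              = ((μI + pI) * (1 + nsq wI)) * Real.sinh (WI - Z) * (Real.sqrt (1 + nsq wI))⁻¹ * wI j) := by
  obtain ⟨n, rfl⟩ : ∃ n, d = n + 1 := ⟨d - 1, by omega⟩
  change Fin n → ℝ at wI wII
  change _ ↔ _ ∧ _ ∧ ∀ j : Fin n, _
  have hI : 0 < 1 + nsq wI := by linarith [nsq_nonneg wI]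
  have hII : 0 < 1 + nsq wII := by linarith [nsq_nonneg wII]
  have sI := mul_self_sqrt hI.le
  have sII := mul_self_sqrt hII.le
  have rI : (1 + nsq wI) * (√(1 + nsq wI))⁻¹ = √(1 + nsq wI) := by
    rw [← div_eq_mul_inv, div_sqrt]
  have rII : (1 + nsq wII) * (√(1 + nsq wII))⁻¹ = √(1 + nsq wII) := by
    rw [← div_eq_mul_inv, div_sqrt]
  have eI := eta_vel_normalV n WI Z wI
  have eII := eta_vel_normalV n WII Z wII
  rw [RH, Fin.forall_fin_succ, Fin.forall_fin_succ, eI, eII]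
  simp only [vel_zero, vel_one, vel_succ_succ, normalV_zero, normalV_one, normalV_succ_succ]
  obtain ⟨XI, rfl⟩ : ∃ X, WI = X + Z := ⟨WI - Z, by ring⟩
  obtain ⟨XII, rfl⟩ : ∃ X, WII = X + Z := ⟨WII - Z, by ring⟩
  simp only [add_sub_cancel_right, cosh_add, sinh_add, sinh_two_mul]
  rw [← and_assoc, ← and_assoc]
  refine and_congr ?_ (forall_congr' fun j => ?_)
  · have key := boost_eq_zero_iff
      ((μII + pII) * (1 + nsq wII) * sinh XII * cosh XII
        - (μI + pI) * (1 + nsq wI) * sinh XI * cosh XI)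
      ((μII + pII) * (1 + nsq wII) * sinh XII ^ 2
        - (μI + pI) * (1 + nsq wI) * sinh XI ^ 2 + (pII - pI)) Z
    refine Iff.trans (and_congr (Eq.congr ?_ rfl) (Eq.congr ?_ rfl))
      (key.trans (and_congr ?_ ?_))
    · linear_combination ((μII + pII) * sinh XII * (cosh XII * cosh Z + sinh XII * sinh Z)) * sII
        - ((μI + pI) * sinh XI * (cosh XI * cosh Z + sinh XI * sinh Z)) * sI
    · linear_combination ((μII + pII) * sinh XII * (sinh XII * cosh Z + cosh XII * sinh Z)) * sII
        - ((μI + pI) * sinh XI * (sinh XI * cosh Z + cosh XI * sinh Z)) * sI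
    · constructor <;> intro h <;> linear_combination h
    · constructor <;> intro h
      · linear_combination 2 * h
      · linear_combination h / 2
  · rw [← sub_eq_zero (b := _ * wI j)]
    refine Eq.congr ?_ rfl
    linear_combination (-(μII + pII) * sinh XII * wII j) * rII + (μI + pI) * sinh XI * wI j * rI
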